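/- (Theorem 1, data reconstruction counting) In the Algorithm-1 storage structure with L ≥ 1 and nI ≥ 2, let k be an integer with 1 ≤ k ≤ n = L·nI, and set q = ⌊k/nI⌋ and r = k mod nI. Then for every set S of k distinct nodes, the number of distinct coded symbols stored on at least one node of S is at least k·nI − (q·nI² + r² + k)/2. (Hence, since the θ = C(nI,2)·L coded symbols are obtained from M = k·nI − (q·nI² + r² + k)/2 source symbols by a (θ, M)-MDS code, any k nodes suffice to recover the original file.) -/

import Mathlib

open Finset in
/-- The edges of a complete graph that avoid a vertex set `A` are the edges inside `Aᶜ`. -/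
theorem card_edges_meeting_add_choose {α : Type*} [Fintype α] [DecidableEq α] (A : Finset α)
    [DecidablePred fun e : {e : Sym2 α // ¬ e.IsDiag} => ∃ j ∈ A, j ∈ e.val] :
    #{e : {e : Sym2 α // ¬ e.IsDiag} | ∃ j ∈ A, j ∈ e.val} + (#Aᶜ).choose 2
      = (Fintype.card α).choose 2 := by
  have h : #{e : {e : Sym2 α // ¬ e.IsDiag} | ¬ ∃ j ∈ A, j ∈ e.val} = (#Aᶜ).choose 2 := by
    rw [← Sym2.card_image_offDiag, ← card_map (Function.Embedding.subtype _)]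
    congr 1
    ext e
    induction e with
    | _ x y =>
      simp only [mem_map, mem_filter, mem_univ, true_and, Function.Embedding.coe_subtype,
        Subtype.exists, exists_and_right, exists_eq_right, mem_image, mem_offDiag, mem_compl,
        Prod.exists, Sym2.mk_isDiag_iff, Sym2.mem_iff]
      grind
  rw [← h, card_filter_add_card_filter_not, card_univ, Sym2.card_subtype_not_diag]

open Finset in
theorem two_mul_card_edges_meeting {α : Type*} [Fintype α] [DecidableEq α] (A : Finset α)
    [DecidablePred fun e : {e : Sym2 α // ¬ e.IsDiag} => ∃ j ∈ A, j ∈ e.val] :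
    2 * (#{e : {e : Sym2 α // ¬ e.IsDiag} | ∃ j ∈ A, j ∈ e.val} : ℤ)
      = 2 * Fintype.card α * #A - (#A : ℤ) ^ 2 - #A := by
  have two_mul_choose (m : ℕ) : 2 * (m.choose 2 : ℤ) = m * (m - 1) := by
    have := Nat.cast_choose_two ℚ m
    have h : (2 * (m.choose 2 : ℤ) : ℚ) = m * (m - 1) := by
      push_cast
      rw [this]
      ring
    exact_mod_cast h
  have h := congrArg (Nat.cast (R := ℤ)) (card_edges_meeting_add_choose A)
  have hc := congrArg (Nat.cast (R := ℤ)) (card_add_card_compl A)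
  push_cast at h hc
  have h₁ := two_mul_choose #Aᶜ
  have h₂ := two_mul_choose (Fintype.card α)
  have hc' : (#Aᶜ : ℤ) = Fintype.card α - #A := by linarith
  rw [hc'] at h₁
  linear_combination 2 * h - h₁ + h₂

theorem div_mul_sq_add_mod_sq_add_sq_le (m K a : ℕ) (hm : 0 < m) (ha : a ≤ m) :
    K / m * m ^ 2 + (K % m) ^ 2 + a ^ 2 ≤ (K + a) / m * m ^ 2 + ((K + a) % m) ^ 2 := by
  have hr := Nat.mod_lt K hm
  have hK := Nat.div_add_mod K m
  generalize K / m = q at *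
  generalize K % m = r at *
  obtain h | h := lt_or_ge (r + a) m
  · obtain ⟨hd, hmod⟩ := (Nat.div_mod_unique hm).2
      (⟨by linarith, h⟩ : r + a + m * q = K + a ∧ r + a < m)
    rw [hd, hmod]
    nlinarith [Nat.zero_le (r * a)]
  · obtain ⟨t, ht⟩ := Nat.exists_eq_add_of_le h
    obtain ⟨hd, hmod⟩ := (Nat.div_mod_unique hm).2
      (⟨by linarith, by omega⟩ : t + m * (q + 1) = K + a ∧ t < m)
    rw [hd, hmod]
    zify at *
    have ht' : (t : ℤ) = r + a - m := by linarith
    rw [ht']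
    nlinarith [mul_nonneg (sub_nonneg.2 hr.le) (sub_nonneg.2 ha)]

/-- Among families of natural numbers bounded by `m` with a given sum, the sum of squares is
largest when all but one of the nonzero terms equal `m`. -/
theorem sum_sq_le_div_mul_sq_add_mod_sq {ι : Type*} (s : Finset ι) (a : ι → ℕ) (m : ℕ)
    (hm : 0 < m) (ha : ∀ i ∈ s, a i ≤ m) :
    ∑ i ∈ s, a i ^ 2 ≤ (∑ i ∈ s, a i) / m * m ^ 2 + ((∑ i ∈ s, a i) % m) ^ 2 := by
  classical
  induction s using Finset.induction_on with
  | empty => simp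
  | insert i s hi ih =>
    rw [Finset.sum_insert hi, Finset.sum_insert hi]
    have h := ih fun j hj => ha j (Finset.mem_insert_of_mem hj)
    have h' := div_mul_sq_add_mod_sq_add_sq_le m (∑ i ∈ s, a i) (a i) hm
      (ha i (Finset.mem_insert_self i s))
    rw [add_comm (a i) (∑ i ∈ s, a i)]
    linarith

/-- Theorem 1 (data reconstruction counting): in the Algorithm-1 storage structure, any set
of `k` nodes retrieves at least `k nI − (q nI² + r² + k)/2` distinct coded symbols. -/
theorem algorithm1_reconstruction_bound (L nI : ℕ) (hL : 1 ≤ L) (hnI : 2 ≤ nI)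
    (n : ℕ) (hn : n = L * nI) (k : ℕ) (hk1 : 1 ≤ k) (hk2 : k ≤ n)
    (q r : ℕ) (hq : q = k / nI) (hr : r = k % nI)
    (stores : (Fin L × Fin nI) → (Fin L × {e : Sym2 (Fin nI) // ¬ e.IsDiag}) → Prop)
    (hstores : ∀ v s, stores v s ↔ (v.1 = s.1 ∧ v.2 ∈ s.2.val))
    (S : Finset (Fin L × Fin nI)) (hS : S.card = k) :
    (({s | ∃ v ∈ S, stores v s}.ncard : ℤ)) ≥
      (k : ℤ) * (nI : ℤ) - ((q : ℤ) * (nI : ℤ) ^ 2 + (r : ℤ) ^ 2 + (k : ℤ)) / 2 := by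
  let A (l : Fin L) : Finset (Fin nI) := {j | (l, j) ∈ S}
  let E (l : Fin L) : Finset {e : Sym2 (Fin nI) // ¬ e.IsDiag} := {e | ∃ j ∈ A l, j ∈ e.val}
  have hncard : {s | ∃ v ∈ S, stores v s}.ncard = ∑ l, (E l).card := by
    rw [← Finset.card_sigma,
      ← Finset.card_map (Equiv.sigmaEquivProd _ _).toEmbedding, ← Set.ncard_coe_finset]
    congr 1
    ext ⟨l, e⟩
    simp [hstores, E, A]
  have hsum : ∑ l, (A l).card = k := by
    rw [← hS, ← Finset.card_sigma,
      ← Finset.card_map (Equiv.sigmaEquivProd _ _).toEmbedding]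
    congr 1
    ext ⟨l, j⟩
    simp [A]
  have hsq := sum_sq_le_div_mul_sq_add_mod_sq Finset.univ (fun l => (A l).card) nI (by omega)
    fun l _ => by simpa using Finset.card_le_univ (A l)
  simp only [hsum, ← hq, ← hr] at hsq
  have htwo : 2 * ((∑ l, (E l).card : ℕ) : ℤ)
      = 2 * nI * k - ((∑ l, (A l).card ^ 2 : ℕ) : ℤ) - k := by
    rw [← hsum]
    push_cast
    rw [Finset.mul_sum, Finset.mul_sum, ← Finset.sum_sub_distrib, ← Finset.sum_sub_distrib]
    refine Finset.sum_congr rfl fun l _ => ?_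
    simpa [E] using two_mul_card_edges_meeting (A l)
  rw [hncard]
  have heven : (2 : ℤ) ∣ q * (nI : ℤ) ^ 2 + (r : ℤ) ^ 2 + k := by
    have hk : (k : ℤ) = nI * q + r := by
      rw [hq, hr]
      exact_mod_cast (Nat.div_add_mod k nI).symm
    have h : (q * (nI : ℤ) ^ 2 + (r : ℤ) ^ 2 + k) = q * (nI * (nI + 1)) + r * (r + 1) := by
      rw [hk]
      ring
    rw [h]
    exact dvd_add ((Int.even_mul_succ_self _).two_dvd.mul_left _)
      (Int.even_mul_succ_self _).two_dvd
  have hhalf := Int.mul_ediv_cancel' heven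
  zify at hsq
  push_cast at htwo ⊢
  linarith
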